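/- The Frattini ideal φ(P) of a finite-dimensional Poisson algebra P is nilpotent. -/

import Mathlib

/-!  Framework: dialgebras and Poisson algebras as bilinear structures on a module. -/

variable {F P : Type*} [Field F] [AddCommGroup P] [Module F P]

/-- A dialgebra: a vector space with two bilinear multiplications. -/
structure Dialgebra (F P : Type*) [Field F] [AddCommGroup P] [Module F P] where
  mul : P →ₗ[F] P →ₗ[F] P
  bracket : P →ₗ[F] P →ₗ[F] P

namespace Dialgebra

variable (D : Dialgebra F P)

/-- Span of the set of products `a·b`, `a ∈ A`, `b ∈ B`. -/
def pmul (A B : Submodule F P) : Submodule F P :=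
  Submodule.span F (Set.image2 (fun a b => D.mul a b) (A : Set P) (B : Set P))

/-- Span of the set of brackets `[a,b]`, `a ∈ A`, `b ∈ B`. -/
def pbra (A B : Submodule F P) : Submodule F P :=
  Submodule.span F (Set.image2 (fun a b => D.bracket a b) (A : Set P) (B : Set P))

/-- `A·B + [A,B]`. -/
def psq (A B : Submodule F P) : Submodule F P := D.pmul A B ⊔ D.pbra A B

/-- A subalgebra: a subspace closed under both products. -/
def IsSubalgebra (A : Submodule F P) : Prop := D.psq A A ≤ A

/-- An ideal of the dialgebra. -/
def IsIdeal (A : Submodule F P) : Prop :=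
  D.pmul A ⊤ ≤ A ∧ D.pmul ⊤ A ≤ A ∧ D.pbra A ⊤ ≤ A ∧ D.pbra ⊤ A ≤ A

/-- `A` is an ideal of the subalgebra `U`. -/
def IsIdealIn (A U : Submodule F P) : Prop :=
  A ≤ U ∧ D.pmul A U ≤ A ∧ D.pmul U A ≤ A ∧ D.pbra A U ≤ A ∧ D.pbra U A ≤ A

/-- Lower central series of `B`: `B^1 = B`, `B^{n+1} = B^n·B + [B^n,B]`. -/
def lcs (B : Submodule F P) : ℕ → Submodule F P
  | 0 => B
  | n + 1 => D.psq (lcs B n) B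

/-- `B` is nilpotent as a dialgebra. -/
def IsNilpotentSub (B : Submodule F P) : Prop := ∃ n, D.lcs B n = ⊥

/-- Derived series of `B`. -/
def ders (B : Submodule F P) : ℕ → Submodule F P
  | 0 => B
  | n + 1 => D.psq (ders B n) (ders B n)

/-- `B` is solvable as a dialgebra. -/
def IsSolvableSub (B : Submodule F P) : Prop := ∃ n, D.ders B n = ⊥

/-- Associative powers: `apow B n = B_A^{n+1}`, i.e. `apow B 0 = B_A^1 = B`. -/
def apow (B : Submodule F P) : ℕ → Submodule F P
  | 0 => B
  | n + 1 => D.pmul (apow B n) B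

/-- Lie powers: `lpow B n = B_L^{n+1}`. -/
def lpow (B : Submodule F P) : ℕ → Submodule F P
  | 0 => B
  | n + 1 => D.pbra (lpow B n) B

/-- Associative nilpotency of `B`. -/
def AssocNilpotent (B : Submodule F P) : Prop := ∃ n, D.apow B n = ⊥

/-- Lie nilpotency of `B`. -/
def LieNilpotent (B : Submodule F P) : Prop := ∃ n, D.lpow B n = ⊥

/-- `mulPows B X n = X·B_A^n` (with the convention that it is `X` for `n = 0`). -/
def mulPows (B X : Submodule F P) : ℕ → Submodule F P
  | 0 => X
  | n + 1 => D.pmul (mulPows B X n) B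

/-- `M` is a maximal (proper) subalgebra of the subalgebra `U`. -/
def IsMaximalSubalgebraIn (U M : Submodule F P) : Prop :=
  D.IsSubalgebra M ∧ M < U ∧ ∀ K, D.IsSubalgebra K → M ≤ K → K ≤ U → K = M ∨ K = U

/-- Frattini subalgebra of the subalgebra `U`: intersection of its maximal subalgebras. -/
def frattiniIn (U : Submodule F P) : Submodule F P :=
  U ⊓ sInf {M | D.IsMaximalSubalgebraIn U M}

/-- Frattini ideal of the subalgebra `U`: largest ideal of `U` inside `frattiniIn U`. -/
def phiIn (U : Submodule F P) : Submodule F P :=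
  sSup {I | D.IsIdealIn I U ∧ I ≤ D.frattiniIn U}

/-- Frattini subalgebra of the dialgebra. -/
def frattini : Submodule F P := D.frattiniIn ⊤

/-- Frattini ideal of the dialgebra. -/
def phi : Submodule F P := sSup {I | D.IsIdeal I ∧ I ≤ D.frattini}

/-- Minimal ideal. -/
def IsMinimalIdeal (A : Submodule F P) : Prop :=
  D.IsIdeal A ∧ A ≠ ⊥ ∧ ∀ I, D.IsIdeal I → I ≤ A → I = ⊥ ∨ I = A

/-- Zero (trivial-multiplication) subspace. -/
def IsZeroAlg (A : Submodule F P) : Prop := D.pmul A A = ⊥ ∧ D.pbra A A = ⊥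

/-- Zero socle: sum of the minimal zero ideals. -/
def zsoc : Submodule F P := sSup {A | D.IsMinimalIdeal A ∧ D.IsZeroAlg A}

/-- Socle: sum of the minimal ideals. -/
def soc : Submodule F P := sSup {A | D.IsMinimalIdeal A}

/-- Annihilator of `B` in the algebra. -/
def annih (B : Submodule F P) : Submodule F P where
  carrier := {x | ∀ b ∈ B, D.mul x b = 0 ∧ D.bracket x b = 0}
  add_mem' := by
    intro x y hx hy b hb
    have h1 := hx b hb; have h2 := hy b hb
    constructor <;> simp [map_add, LinearMap.add_apply, h1.1, h1.2, h2.1, h2.2]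
  zero_mem' := by intro b hb; simp
  smul_mem' := by
    intro c x hx b hb
    have h := hx b hb
    constructor <;> simp [map_smul, LinearMap.smul_apply, h.1, h.2]

/-- `R` is the solvable radical: the largest solvable ideal. -/
def IsRadical (R : Submodule F P) : Prop :=
  D.IsIdeal R ∧ D.IsSolvableSub R ∧ ∀ I, D.IsIdeal I → D.IsSolvableSub I → I ≤ R

/-- `N` is the nilradical: the largest nilpotent ideal. -/
def IsNilradical (N : Submodule F P) : Prop :=
  D.IsIdeal N ∧ D.IsNilpotentSub N ∧ ∀ I, D.IsIdeal I → D.IsNilpotentSub I → I ≤ N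

end Dialgebra

/-- A Poisson algebra: commutative associative product and Lie bracket linked by the Leibniz rule. -/
structure PoissonAlgebra (F P : Type*) [Field F] [AddCommGroup P] [Module F P]
    extends Dialgebra F P where
  mul_comm : ∀ x y, mul x y = mul y x
  mul_assoc : ∀ x y z, mul (mul x y) z = mul x (mul y z)
  lie_self : ∀ x, bracket x x = 0
  leibniz_lie : ∀ x y z, bracket x (bracket y z) = bracket (bracket x y) z + bracket y (bracket x z)
  leibniz : ∀ x y z, bracket (mul x y) z = mul (bracket x z) y + mul x (bracket y z)
namespace Dialgebra

variable (D : Dialgebra F P)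

theorem mul_mem_pmul {A B : Submodule F P} {a b : P} (ha : a ∈ A) (hb : b ∈ B) :
    D.mul a b ∈ D.pmul A B :=
  Submodule.subset_span ⟨a, ha, b, hb, rfl⟩

theorem bracket_mem_pbra {A B : Submodule F P} {a b : P} (ha : a ∈ A) (hb : b ∈ B) :
    D.bracket a b ∈ D.pbra A B :=
  Submodule.subset_span ⟨a, ha, b, hb, rfl⟩

theorem pmul_le {A B C : Submodule F P} :
    D.pmul A B ≤ C ↔ ∀ a ∈ A, ∀ b ∈ B, D.mul a b ∈ C := by
  simp only [pmul, Submodule.span_le, Set.image2_subset_iff, SetLike.mem_coe]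

theorem pbra_le {A B C : Submodule F P} :
    D.pbra A B ≤ C ↔ ∀ a ∈ A, ∀ b ∈ B, D.bracket a b ∈ C := by
  simp only [pbra, Submodule.span_le, Set.image2_subset_iff, SetLike.mem_coe]

theorem isSubalgebra_iff {A : Submodule F P} :
    D.IsSubalgebra A ↔ ∀ x ∈ A, ∀ y ∈ A, D.mul x y ∈ A ∧ D.bracket x y ∈ A := by
  simp only [IsSubalgebra, psq, sup_le_iff, pmul_le, pbra_le]
  grind

theorem mul_mem_phi {x : P} (hx : x ∈ D.phi) (y : P) : D.mul x y ∈ D.phi := by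
  have h : D.phi ≤ D.phi.comap (D.mul.flip y) := sSup_le fun I hI z hz =>
    le_sSup hI (hI.1.1 (D.mul_mem_pmul hz trivial))
  exact h hx

theorem bracket_mem_phi {x : P} (hx : x ∈ D.phi) (y : P) : D.bracket x y ∈ D.phi := by
  have h : D.phi ≤ D.phi.comap (D.bracket.flip y) := sSup_le fun I hI z hz =>
    le_sSup hI (hI.1.2.2.1 (D.bracket_mem_pbra hz trivial))
  exact h hx

theorem phi_le_of_isMaximalSubalgebraIn {M : Submodule F P}
    (hM : D.IsMaximalSubalgebraIn ⊤ M) : D.phi ≤ M :=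
  sSup_le fun _ hI => hI.2.trans (inf_le_right.trans (sInf_le hM))

/-- The Frattini ideal consists of non-generators. -/
theorem eq_top_of_sup_phi_eq_top [FiniteDimensional F P] {M : Submodule F P}
    (hM : D.IsSubalgebra M) (h : M ⊔ D.phi = ⊤) : M = ⊤ := by
  by_contra hne
  obtain ⟨N, ⟨hN, hMN, hN_top⟩, hmax⟩ := wellFounded_gt.has_min
    {N : Submodule F P | D.IsSubalgebra N ∧ M ≤ N ∧ N ≠ ⊤} ⟨M, hM, le_rfl, hne⟩
  have hN_max : D.IsMaximalSubalgebraIn ⊤ N := by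
    refine ⟨hN, lt_top_iff_ne_top.2 hN_top, fun K hK hNK _ => ?_⟩
    by_contra! hK_ne
    exact hmax K ⟨hK, hMN.trans hNK, hK_ne.2⟩ (lt_of_le_of_ne hNK hK_ne.1.symm)
  exact hN_top (top_le_iff.1 (h ▸ sup_le hMN (D.phi_le_of_isMaximalSubalgebraIn hN_max)))

/-- An operator with values in the Frattini ideal whose Fitting null component is a subalgebra
is nilpotent. -/
theorem isNilpotent_of_range_le_phi [FiniteDimensional F P] (T : Module.End F P)
    (hT : ∀ x, T x ∈ D.phi)
    (h : ∀ n x y, (T ^ n) x = 0 → (T ^ n) y = 0 →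
      (T ^ (n + n + 1)) (D.mul x y) = 0 ∧ (T ^ (n + n + 1)) (D.bracket x y) = 0) :
    IsNilpotent T := by
  obtain ⟨n, hc, hk, hn⟩ := ((LinearMap.eventually_isCompl_ker_pow_range_pow T).and
    ((LinearMap.eventually_iSup_ker_pow_eq T).and (Filter.eventually_ge_atTop 1))).exists
  have hker : ∀ m x, (T ^ m) x = 0 → x ∈ LinearMap.ker (T ^ n) := fun m x hx =>
    hk ▸ Submodule.mem_iSup_of_mem m hx
  have hsub : D.IsSubalgebra (LinearMap.ker (T ^ n)) := D.isSubalgebra_iff.2 fun x hx y hy =>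
    ⟨hker _ _ (h n x y hx hy).1, hker _ _ (h n x y hx hy).2⟩
  have hrange : LinearMap.range (T ^ n) ≤ D.phi := by
    rintro _ ⟨x, rfl⟩
    obtain ⟨m, rfl⟩ := Nat.exists_eq_add_of_le' hn
    rw [pow_succ', Module.End.mul_apply]
    exact hT _
  refine ⟨n, LinearMap.ker_eq_top.1 (D.eq_top_of_sup_phi_eq_top hsub ?_)⟩
  exact top_le_iff.1 (hc.sup_eq_top ▸ sup_le_sup_left hrange _)

end Dialgebra

section

attribute [local instance] LieRing.ofAssociativeRing

/-- Engel's theorem for Lie algebras of endomorphisms. -/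
theorem LieSubalgebra.exists_lowerCentralSeries_eq_bot [FiniteDimensional F P]
    (S : LieSubalgebra F (Module.End F P))
    (hS : ∀ T ∈ S, IsNilpotent T) : ∃ n, LieModule.lowerCentralSeries F S P n = ⊥ := by
  have : LieModule.IsNilpotent S P := by
    rw [LieModule.isNilpotent_iff_forall (R := F)]
    rintro ⟨T, hT⟩
    exact hS T hT
  exact (LieModule.isNilpotent_iff F S P).1 this

theorem Module.End.pow_add_apply_eq_zero_of_derivation (T : Module.End F P) (m : P →ₗ[F] P →ₗ[F] P)
    (hm : ∀ x y, T (m x y) = m (T x) y + m x (T y)) (i j : ℕ) (x y : P)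
    (hx : (T ^ i) x = 0) (hy : (T ^ j) y = 0) : (T ^ (i + j)) (m x y) = 0 := by
  induction hs : i + j generalizing i j x y with
  | zero =>
    obtain ⟨rfl, rfl⟩ : i = 0 ∧ j = 0 := by omega
    simp_all
  | succ s ih =>
    rcases i with _ | i
    · simp_all
    rcases j with _ | j
    · simp_all
    rw [pow_succ, Module.End.mul_apply, hm, map_add,
      ih i (j + 1) (T x) y (by rwa [pow_succ, Module.End.mul_apply] at hx) hy (by omega),
      ih (i + 1) j x (T y) hx (by rwa [pow_succ, Module.End.mul_apply] at hy) (by omega), add_zero]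

namespace PoissonAlgebra

variable (Q : PoissonAlgebra F P)

theorem bracket_skew (x y : P) : Q.bracket x y = -Q.bracket y x := by
  have h := Q.lie_self (x + y)
  simp only [map_add, LinearMap.add_apply, Q.lie_self, zero_add, add_zero] at h
  exact eq_neg_of_add_eq_zero_right h

theorem bracket_mul (a x y : P) :
    Q.bracket a (Q.mul x y) = Q.mul (Q.bracket a x) y + Q.mul x (Q.bracket a y) := by
  rw [Q.bracket_skew, Q.leibniz, Q.bracket_skew a x, Q.bracket_skew a y]
  simp only [map_neg, LinearMap.neg_apply, neg_add]

theorem mul_pow_apply_mul (a x y : P) (n : ℕ) :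
    (Q.mul a ^ n : Module.End F P) (Q.mul x y) = Q.mul ((Q.mul a ^ n : Module.End F P) x) y := by
  induction n with
  | zero => simp
  | succ n ih => rw [pow_succ', Module.End.mul_apply, ih, Module.End.mul_apply, Q.mul_assoc]

theorem mul_pow_succ_apply_bracket_eq_zero (a x y : P) (n : ℕ)
    (hx : (Q.mul a ^ n : Module.End F P) x = 0) :
    (Q.mul a ^ (n + 1) : Module.End F P) (Q.bracket x y) = 0 := by
  induction n generalizing x with
  | zero => simp_all
  | succ n ih =>
    have h := ih (Q.mul a x) (by rwa [pow_succ, Module.End.mul_apply] at hx)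
    rw [Q.leibniz, map_add, Q.mul_comm, Q.mul_pow_apply_mul, hx, map_zero, LinearMap.zero_apply,
      zero_add] at h
    rwa [pow_succ, Module.End.mul_apply]

theorem isNilpotent_mul_of_mem_phi [FiniteDimensional F P] {a : P} (ha : a ∈ Q.phi) :
    IsNilpotent (Q.mul a : Module.End F P) := by
  refine Q.isNilpotent_of_range_le_phi _ (Q.mul_mem_phi ha) fun n x y hx _ => ⟨?_, ?_⟩
  · rw [Q.mul_pow_apply_mul, show n + n + 1 = (n + 1) + n by ring, pow_add,
      Module.End.mul_apply, hx]
    simp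
  · rw [show n + n + 1 = n + (n + 1) by ring, pow_add, Module.End.mul_apply,
      Q.mul_pow_succ_apply_bracket_eq_zero a x y n hx, map_zero]

theorem isNilpotent_bracket_of_mem_phi [FiniteDimensional F P] {a : P} (ha : a ∈ Q.phi) :
    IsNilpotent (Q.bracket a : Module.End F P) := by
  refine Q.isNilpotent_of_range_le_phi _ (Q.bracket_mem_phi ha) fun n x y hx hy => ?_
  rw [pow_succ', Module.End.mul_apply, Module.End.mul_apply,
    Module.End.pow_add_apply_eq_zero_of_derivation _ Q.mul (Q.bracket_mul a) n n x y hx hy,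
    Module.End.pow_add_apply_eq_zero_of_derivation _ Q.bracket (Q.leibniz_lie a) n n x y hx hy]
  simp

/-- The Lie algebra of multiplications by elements of a subspace. -/
def mulLieSubalgebra (B : Submodule F P) : LieSubalgebra F (Module.End F P) where
  __ := B.map Q.mul
  lie_mem' := by
    rintro _ _ ⟨a, -, rfl⟩ ⟨b, -, rfl⟩
    have h : ⁅(Q.mul a : Module.End F P), (Q.mul b : Module.End F P)⁆ = 0 := by
      ext x
      rw [LieRing.of_associative_ring_bracket, LinearMap.sub_apply, Module.End.mul_apply,
        Module.End.mul_apply, ← Q.mul_assoc, ← Q.mul_assoc, Q.mul_comm a b, sub_self,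
        LinearMap.zero_apply]
    exact h ▸ Submodule.zero_mem _

/-- The Lie algebra of inner derivations by elements of a Lie-closed subspace. -/
def adLieSubalgebra (B : Submodule F P) (hB : ∀ a ∈ B, ∀ b ∈ B, Q.bracket a b ∈ B) :
    LieSubalgebra F (Module.End F P) where
  __ := B.map Q.bracket
  lie_mem' := by
    rintro _ _ ⟨a, ha, rfl⟩ ⟨b, hb, rfl⟩
    refine ⟨Q.bracket a b, hB a ha b hb, ?_⟩
    ext x
    rw [LieRing.of_associative_ring_bracket, LinearMap.sub_apply, Module.End.mul_apply,
      Module.End.mul_apply, Q.leibniz_lie a b x, add_sub_cancel_right]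

theorem apow_le_lowerCentralSeries (B : Submodule F P) (n : ℕ) :
    Q.apow B n ≤ (LieModule.lowerCentralSeries F (Q.mulLieSubalgebra B) P n).toSubmodule := by
  induction n with
  | zero => exact fun _ _ => trivial
  | succ n ih =>
    refine Q.pmul_le.2 fun a ha b hb => ?_
    rw [Q.mul_comm, LieModule.lowerCentralSeries_succ]
    exact LieSubmodule.lie_mem_lie (x := (⟨Q.mul b, b, hb, rfl⟩ : Q.mulLieSubalgebra B))
      (LieSubmodule.mem_top _) (ih ha)

theorem lpow_le_lowerCentralSeries (B : Submodule F P)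
    (hB : ∀ a ∈ B, ∀ b ∈ B, Q.bracket a b ∈ B) (n : ℕ) :
    Q.lpow B n ≤ (LieModule.lowerCentralSeries F (Q.adLieSubalgebra B hB) P n).toSubmodule := by
  induction n with
  | zero => exact fun _ _ => trivial
  | succ n ih =>
    refine Q.pbra_le.2 fun a ha b hb => ?_
    rw [Q.bracket_skew, LieModule.lowerCentralSeries_succ]
    exact Submodule.neg_mem _ (LieSubmodule.lie_mem_lie
      (x := (⟨Q.bracket b, b, hb, rfl⟩ : Q.adLieSubalgebra B hB))
      (LieSubmodule.mem_top _) (ih ha))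

theorem assocNilpotent_phi [FiniteDimensional F P] : Q.AssocNilpotent Q.phi := by
  obtain ⟨n, hn⟩ := (Q.mulLieSubalgebra Q.phi).exists_lowerCentralSeries_eq_bot <| by
    rintro _ ⟨a, ha, rfl⟩
    exact Q.isNilpotent_mul_of_mem_phi ha
  exact ⟨n, le_bot_iff.1 ((Q.apow_le_lowerCentralSeries Q.phi n).trans (by simp [hn]))⟩

theorem lieNilpotent_phi [FiniteDimensional F P] : Q.LieNilpotent Q.phi := by
  have hB : ∀ a ∈ Q.phi, ∀ b ∈ Q.phi, Q.bracket a b ∈ Q.phi := fun a ha b _ =>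
    Q.bracket_mem_phi ha b
  obtain ⟨n, hn⟩ := (Q.adLieSubalgebra Q.phi hB).exists_lowerCentralSeries_eq_bot <| by
    rintro _ ⟨a, ha, rfl⟩
    exact Q.isNilpotent_bracket_of_mem_phi ha
  exact ⟨n, le_bot_iff.1 ((Q.lpow_le_lowerCentralSeries Q.phi hB n).trans (by simp [hn]))⟩

theorem bracket_mem_apow {B : Submodule F P} (hB : Q.IsSubalgebra B) (n : ℕ) {a b : P}
    (ha : a ∈ Q.apow B n) (hb : b ∈ B) : Q.bracket a b ∈ Q.apow B n := by
  induction n generalizing a with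
  | zero => exact (Q.isSubalgebra_iff.1 hB a ha b hb).2
  | succ n ih =>
    have h : Q.apow B (n + 1) ≤ (Q.apow B (n + 1)).comap (Q.bracket.flip b) := by
      refine Q.pmul_le.2 fun x hx y hy => ?_
      rw [Submodule.mem_comap, LinearMap.flip_apply, Q.leibniz]
      exact add_mem (Q.mul_mem_pmul (ih hx) hy)
        (Q.mul_mem_pmul hx (Q.isSubalgebra_iff.1 hB y hy b hb).2)
    exact h ha

theorem apow_succ_le {B : Submodule F P} (hB : Q.IsSubalgebra B) (n : ℕ) :
    Q.apow B (n + 1) ≤ Q.apow B n := by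
  induction n with
  | zero => exact Q.pmul_le.2 fun x hx y hy => (Q.isSubalgebra_iff.1 hB x hx y hy).1
  | succ n ih => exact Q.pmul_le.2 fun x hx y hy => Q.mul_mem_pmul (ih hx) hy

theorem apow_le {B : Submodule F P} (hB : Q.IsSubalgebra B) (n : ℕ) : Q.apow B n ≤ B := by
  induction n with
  | zero => exact le_rfl
  | succ n ih => exact (Q.apow_succ_le hB n).trans ih

theorem psq_sup_inf_le {B X : Submodule F P} (hB : Q.IsSubalgebra B) (k j : ℕ)
    (hX : X ≤ Q.apow B (k + 1) ⊔ (Q.apow B k ⊓ Q.lpow B j)) :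
    Q.psq X B ≤ Q.apow B (k + 1) ⊔ (Q.apow B k ⊓ Q.lpow B (j + 1)) := by
  refine sup_le (Q.pmul_le.2 fun x hx b hb => ?_) (Q.pbra_le.2 fun x hx b hb => ?_) <;>
    obtain ⟨y, hy, z, ⟨hzk, hzj⟩, rfl⟩ := Submodule.mem_sup.1 (hX hx) <;>
    rw [map_add, LinearMap.add_apply]
  · exact Submodule.mem_sup_left (add_mem (Q.mul_mem_pmul (Q.apow_succ_le hB k hy) hb)
      (Q.mul_mem_pmul hzk hb))
  · exact Submodule.add_mem_sup (Q.bracket_mem_apow hB _ hy hb)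
      ⟨Q.bracket_mem_apow hB _ hzk hb, Q.bracket_mem_pbra hzj hb⟩

/-- A subalgebra that is nilpotent for each of the two products is nilpotent. -/
theorem isNilpotentSub_of_assocNilpotent_of_lieNilpotent {B : Submodule F P}
    (hB : Q.IsSubalgebra B) (hA : Q.AssocNilpotent B) (hL : Q.LieNilpotent B) :
    Q.IsNilpotentSub B := by
  obtain ⟨r, hr⟩ := hA
  obtain ⟨m, hm⟩ := hL
  have key : ∀ k, Q.lcs B (k * m) ≤ Q.apow B k := by
    intro k
    induction k with
    | zero => rw [zero_mul]; exact le_rfl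
    | succ k ih =>
      have step : ∀ j, Q.lcs B (k * m + j) ≤
          Q.apow B (k + 1) ⊔ (Q.apow B k ⊓ Q.lpow B j) := by
        intro j
        induction j with
        | zero => exact le_sup_of_le_right (le_inf ih (ih.trans (Q.apow_le hB k)))
        | succ j ihj => exact Q.psq_sup_inf_le hB k j ihj
      simpa [hm, Nat.succ_mul] using step m
  exact ⟨r * m, le_bot_iff.1 (hr ▸ key r)⟩

end PoissonAlgebra

end

/-- The Frattini ideal of a finite-dimensional Poisson algebra is nilpotent. -/
theorem phi_nilpotent {F P : Type*} [Field F] [AddCommGroup P] [Module F P]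
    [FiniteDimensional F P] (Q : PoissonAlgebra F P) :
    Q.toDialgebra.IsNilpotentSub Q.toDialgebra.phi := by
  exact Q.isNilpotentSub_of_assocNilpotent_of_lieNilpotent
    (Q.isSubalgebra_iff.2 fun _ hx y _ => ⟨Q.mul_mem_phi hx y, Q.bracket_mem_phi hx y⟩)
    Q.assocNilpotent_phi Q.lieNilpotent_phi
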